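/- Let P = (p_1,…,p_S) and Q = (q_1,…,q_S) be probability distributions on [S], and suppose their total variation distance TV(P,Q) := (1/2)·Σ_{i=1}^S |p_i − q_i| satisfies TV(P,Q) ≤ ε for some ε ∈ (0, 1/2). Then |H(P) − H(Q)| ≤ H_b(ε) + ε·ln(S), where H(P) := −Σ_i p_i·ln(p_i) is the Shannon entropy (with 0·ln 0 = 0) and H_b(c) := −c·ln(c) − (1−c)·ln(1−c) is the binary entropy. -/

import Mathlib

open scoped BigOperators

namespace Paper

/-- Binary entropy `H_b(c) = −c·ln c − (1−c)·ln(1−c)` (with `H_b(0) = 0`). -/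
noncomputable def binEntropy (c : ℝ) : ℝ :=
  Real.negMulLog c + Real.negMulLog (1 - c)

open Real in
lemma eta_gibbs {x c : ℝ} (hx : 0 ≤ x) (hc : 0 < c) :
    negMulLog x ≤ -x * log c + c - x := by
  rcases hx.eq_or_lt with rfl | hx
  · simp [hc.le]
  · have h := log_le_sub_one_of_pos (div_pos hc hx)
    rw [log_div hc.ne' hx.ne'] at h
    have h2 := mul_le_mul_of_nonneg_left h hx.le
    have h3 : x * (c / x - 1) = c - x := by field_simp
    rw [h3] at h2
    unfold negMulLog
    linarith

open Real in
lemma eta_subadd {x y : ℝ} (hx : 0 ≤ x) (hy : 0 ≤ y) :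
    negMulLog (x + y) ≤ negMulLog x + negMulLog y := by
  rcases hx.eq_or_lt with rfl | hx
  · simp
  rcases hy.eq_or_lt with rfl | hy
  · simp
  have h1 := mul_le_mul_of_nonneg_left (log_le_log hx (by linarith : x ≤ x + y)) hx.le
  have h2 := mul_le_mul_of_nonneg_left (log_le_log hy (by linarith : y ≤ x + y)) hy.le
  unfold negMulLog
  linarith

open Real in
lemma eta_concave {m b d : ℝ} (hm : 0 ≤ m) (hb : 0 ≤ b) (hd0 : 0 < d) (hd1 : d < 1)
    (hbd : b ≤ d) :
    negMulLog m + m * log (1 - d) ≤ negMulLog (m + b) := by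
  have hd : 0 < 1 - d := by linarith
  have h := concaveOn_negMulLog.2 (x := m / (1 - d)) (y := b / d)
    (Set.mem_Ici.2 (by positivity)) (Set.mem_Ici.2 (by positivity)) hd.le hd0.le (by ring)
  simp only [smul_eq_mul] at h
  rw [mul_div_cancel₀ _ hd.ne', mul_div_cancel₀ _ hd0.ne'] at h
  have hn : 0 ≤ negMulLog (b / d) :=
    negMulLog_nonneg (by positivity) ((div_le_one hd0).2 hbd)
  have h3 : (1 - d) * negMulLog (m / (1 - d)) = negMulLog m + m * log (1 - d) := by
    rcases hm.eq_or_lt with rfl | hm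
    · simp
    · unfold negMulLog
      rw [log_div hm.ne' hd.ne']
      field_simp
      ring
  have := mul_nonneg hd0.le hn
  linarith

open Real in
lemma entropy_one_side
    {S : ℕ} (p q : Fin S → ℝ)
    (hp0 : ∀ i, 0 ≤ p i) (hq0 : ∀ i, 0 ≤ q i)
    (hp1 : ∑ i, p i = 1) (hq1 : ∑ i, q i = 1)
    (ε : ℝ) (hε0 : 0 < ε) (hε1 : ε < 1 / 2)
    (hTV : (1 / 2) * ∑ i, |p i - q i| ≤ ε) :
    ∑ i, negMulLog (p i) - ∑ i, negMulLog (q i) ≤ binEntropy ε + ε * log S := by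
  set d := (1 / 2) * ∑ i, |p i - q i| with hd
  have hdd : ∑ i, |p i - q i| = 2 * d := by rw [hd]; ring
  have hS : 0 < S := by
    rcases Nat.eq_zero_or_pos S with rfl | h
    · simp at hp1
    · exact h
  have hS' : (0 : ℝ) < S := by exact_mod_cast hS
  have hlog : 0 ≤ log (S : ℝ) := log_natCast_nonneg S
  have hmono : ∀ x, 0 ≤ x → x ≤ ε → binEntropy x ≤ binEntropy ε := by
    intro x h0 h1
    have := Real.binEntropy_strictMonoOn.monotoneOn (a := x) (b := ε)
      ⟨h0, by norm_num; linarith⟩ ⟨hε0.le, by norm_num; linarith⟩ h1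
    rw [Real.binEntropy_eq_negMulLog_add_negMulLog_one_sub,
      Real.binEntropy_eq_negMulLog_add_negMulLog_one_sub] at this
    exact this
  have hd0 : 0 ≤ d := by
    rw [hd]; exact mul_nonneg (by norm_num) (Finset.sum_nonneg fun i _ => abs_nonneg _)
  have hfin : binEntropy d + d * log S ≤ binEntropy ε + ε * log S :=
    add_le_add (hmono d hd0 hTV) (mul_le_mul_of_nonneg_right hTV hlog)
  refine le_trans ?_ hfin
  rcases hd0.eq_or_lt with h0 | hd0
  · have h1 : ∑ i, |p i - q i| = 0 := by rw [hdd, ← h0]; ring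
    have h2 : p = q := by
      funext i
      have := (Finset.sum_eq_zero_iff_of_nonneg (fun i _ => abs_nonneg (p i - q i))).1 h1 i
        (Finset.mem_univ i)
      exact sub_eq_zero.1 (abs_eq_zero.1 this)
    rw [← h0, h2]
    simp [binEntropy]
  -- decomposition
  obtain ⟨a, ha⟩ : ∃ a : Fin S → ℝ, ∀ i, a i = (|p i - q i| + (p i - q i)) / 2 :=
    ⟨_, fun i => rfl⟩
  obtain ⟨b, hb⟩ : ∃ b : Fin S → ℝ, ∀ i, b i = (|p i - q i| - (p i - q i)) / 2 :=
    ⟨_, fun i => rfl⟩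
  obtain ⟨m, hm⟩ : ∃ m : Fin S → ℝ, ∀ i, m i = p i - a i := ⟨_, fun i => rfl⟩
  have ha0 : ∀ i, 0 ≤ a i := fun i => by
    rw [ha]; linarith [neg_abs_le (p i - q i)]
  have hb0 : ∀ i, 0 ≤ b i := fun i => by
    rw [hb]; linarith [le_abs_self (p i - q i)]
  have hpm : ∀ i, p i = m i + a i := fun i => by rw [hm]; ring
  have hqm : ∀ i, q i = m i + b i := fun i => by rw [hm, ha, hb]; ring
  have hm0 : ∀ i, 0 ≤ m i := fun i => by
    rw [hm, ha]
    rcases abs_cases (p i - q i) with h | h <;> linarith [hp0 i, hq0 i]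
  have hsa : ∑ i, a i = d := by
    simp only [ha]
    rw [← Finset.sum_div, Finset.sum_add_distrib, Finset.sum_sub_distrib, hp1, hq1, hdd]; ring
  have hsb : ∑ i, b i = d := by
    simp only [hb]
    rw [← Finset.sum_div, Finset.sum_sub_distrib, Finset.sum_sub_distrib, hp1, hq1, hdd]; ring
  have hsm : ∑ i, m i = 1 - d := by
    simp only [hm]
    rw [Finset.sum_sub_distrib, hp1, hsa]
  have hbd : ∀ i, b i ≤ d := fun i => by
    rw [← hsb]; exact Finset.single_le_sum (fun j _ => hb0 j) (Finset.mem_univ i)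
  have e1 : ∑ i, negMulLog (p i) ≤ ∑ i, negMulLog (m i) + ∑ i, negMulLog (a i) := by
    rw [← Finset.sum_add_distrib]
    exact Finset.sum_le_sum fun i _ => by rw [hpm i]; exact eta_subadd (hm0 i) (ha0 i)
  have e2 : ∑ i, negMulLog (m i) + (1 - d) * log (1 - d) ≤ ∑ i, negMulLog (q i) := by
    rw [← hsm, Finset.sum_mul, ← Finset.sum_add_distrib, hsm]
    exact Finset.sum_le_sum fun i _ => by
      rw [hqm i]; exact eta_concave (hm0 i) (hb0 i) hd0 (by linarith) (hbd i)
  have e3 : ∑ i, negMulLog (a i) ≤ negMulLog d + d * log S := by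
    calc ∑ i, negMulLog (a i) ≤ ∑ i, (-a i * log (d / S) + d / S - a i) :=
          Finset.sum_le_sum fun i _ => eta_gibbs (ha0 i) (div_pos hd0 hS')
      _ = negMulLog d + d * log S := by
          rw [Finset.sum_sub_distrib, Finset.sum_add_distrib, ← Finset.sum_mul,
            Finset.sum_neg_distrib, hsa, log_div hd0.ne' hS'.ne']
          simp only [Finset.sum_const, Finset.card_univ, Fintype.card_fin, nsmul_eq_mul,
            negMulLog]
          field_simp
          ring
  have e4 : negMulLog (1 - d) = -((1 - d) * log (1 - d)) := by unfold negMulLog; ring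
  unfold binEntropy
  linarith

/-- Fannes-type continuity of entropy in total variation distance,
Lemma app:proofs:prob_ineq, after Theorem 11 of Ho–Yeung: if probability distributions
`P, Q` on `[S]` satisfy `TV(P,Q) ≤ ε` with `ε ∈ (0, 1/2)`, then
`|H(P) − H(Q)| ≤ H_b(ε) + ε·ln S`. -/
theorem entropy_continuity_tv
    {S : ℕ} (p q : Fin S → ℝ)
    (hp0 : ∀ i, 0 ≤ p i) (hq0 : ∀ i, 0 ≤ q i)
    (hp1 : ∑ i, p i = 1) (hq1 : ∑ i, q i = 1)
    (ε : ℝ) (hε0 : 0 < ε) (hε1 : ε < 1 / 2)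
    (hTV : (1 / 2) * ∑ i, |p i - q i| ≤ ε) :
    |∑ i, Real.negMulLog (p i) - ∑ i, Real.negMulLog (q i)| ≤
      binEntropy ε + ε * Real.log S := by
  rw [abs_le]
  have h1 := entropy_one_side p q hp0 hq0 hp1 hq1 ε hε0 hε1 hTV
  have h2 := entropy_one_side q p hq0 hp0 hq1 hp1 ε hε0 hε1
    (by simpa only [abs_sub_comm] using hTV)
  constructor <;> linarith

end Paper
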